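/- arXiv:2102.02796 — 2 statements merged into one kernel-verified Lean document; each statement's English description precedes it below -/
import Mathlib

section
/- Let 𝓕 be a finite set, ω : 𝓕 → ℝ with ω_F > 0 for all F, and λ : 𝓕 → ℕ≥1 × ℕ≥1 → ℂ arbitrary. There exists an absolute constant C > 0 (independent of 𝓕, ω, λ, N) such that for every real N ≥ 1, Δ^{(3)}(N) ≤ C (1 + log N) · sup_{1 ≤ R ≤ 2N} (N/R)^{1/3} Δ^{(2)}(R), where the supremum is over real R with 1 ≤ R ≤ 2N. -/
open Finset

/-- The dual-side norm `Δ^{(2)}(R)`: supremum over unit vectors `b : 𝓕 → ℂ` of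
`∑_{(m,n) : R ≤ m²n ≤ 2R} |∑_F b_F ω_F^{-1/2} λ_F(m,n)|²`, where `m, n` range over
positive integers. -/
noncomputable def DeltaTwo (𝓕 : Type*) [Fintype 𝓕] (ω : 𝓕 → ℝ)
    (lam : 𝓕 → ℕ → ℕ → ℂ) (R : ℝ) : ℝ :=
  ⨆ b : {b : 𝓕 → ℂ // ∑ F, ‖b F‖ ^ 2 = 1},
    ∑' p : ℕ × ℕ,
      if 1 ≤ p.1 ∧ 1 ≤ p.2 ∧ R ≤ (p.1 : ℝ) ^ 2 * (p.2 : ℝ) ∧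
          (p.1 : ℝ) ^ 2 * (p.2 : ℝ) ≤ 2 * R then
        ‖∑ F, b.1 F * ((ω F ^ (-(1 : ℝ) / 2) : ℝ) : ℂ) * lam F p.1 p.2‖ ^ 2
      else 0

/-- The dual-side norm `Δ^{(3)}(R)`: supremum over unit vectors `b : 𝓕 → ℂ` of
`∑_{(d,m,n) : R ≤ d³m²n ≤ 2R} |∑_F b_F ω_F^{-1/2} λ_F(m,n)|²`, where `d, m, n` range
over positive integers. -/
noncomputable def DeltaThree (𝓕 : Type*) [Fintype 𝓕] (ω : 𝓕 → ℝ)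
    (lam : 𝓕 → ℕ → ℕ → ℂ) (R : ℝ) : ℝ :=
  ⨆ b : {b : 𝓕 → ℂ // ∑ F, ‖b F‖ ^ 2 = 1},
    ∑' q : ℕ × ℕ × ℕ,
      if 1 ≤ q.1 ∧ 1 ≤ q.2.1 ∧ 1 ≤ q.2.2 ∧
          R ≤ (q.1 : ℝ) ^ 3 * (q.2.1 : ℝ) ^ 2 * (q.2.2 : ℝ) ∧
          (q.1 : ℝ) ^ 3 * (q.2.1 : ℝ) ^ 2 * (q.2.2 : ℝ) ≤ 2 * R then
        ‖∑ F, b.1 F * ((ω F ^ (-(1 : ℝ) / 2) : ℝ) : ℂ) * lam F q.2.1 q.2.2‖ ^ 2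
      else 0

/-- The dyadic sum `∑_{(m,n) : R ≤ m²n ≤ 2R} f m n` over positive integers. -/
noncomputable def dyadicSumTwo (f : ℕ → ℕ → ℝ) (R : ℝ) : ℝ :=
  ∑' p : ℕ × ℕ,
    if 1 ≤ p.1 ∧ 1 ≤ p.2 ∧ R ≤ (p.1 : ℝ) ^ 2 * (p.2 : ℝ) ∧
        (p.1 : ℝ) ^ 2 * (p.2 : ℝ) ≤ 2 * R then f p.1 p.2 else 0

/-- The dyadic sum `∑_{(d,m,n) : R ≤ d³m²n ≤ 2R} f m n` over positive integers. -/
noncomputable def dyadicSumThree (f : ℕ → ℕ → ℝ) (R : ℝ) : ℝ :=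
  ∑' q : ℕ × ℕ × ℕ,
    if 1 ≤ q.1 ∧ 1 ≤ q.2.1 ∧ 1 ≤ q.2.2 ∧
        R ≤ (q.1 : ℝ) ^ 3 * (q.2.1 : ℝ) ^ 2 * (q.2.2 : ℝ) ∧
        (q.1 : ℝ) ^ 3 * (q.2.1 : ℝ) ^ 2 * (q.2.2 : ℝ) ≤ 2 * R then f q.2.1 q.2.2 else 0

lemma dyadicSumTwo_nonneg {f : ℕ → ℕ → ℝ} (hf : ∀ m n, 0 ≤ f m n) (R : ℝ) :
    0 ≤ dyadicSumTwo f R :=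
  tsum_nonneg fun p => by split_ifs <;> simp [hf]

lemma le_floor_of_sq_mul_le {m n : ℕ} {X : ℝ} (hm : 1 ≤ m) (hn : 1 ≤ n)
    (h : (m : ℝ) ^ 2 * n ≤ X) : m ≤ ⌊X⌋₊ ∧ n ≤ ⌊X⌋₊ := by
  have hm' : (1 : ℝ) ≤ m := by exact_mod_cast hm
  have hn' : (1 : ℝ) ≤ n := by exact_mod_cast hn
  constructor <;> apply Nat.le_floor <;> refine le_trans ?_ h
  · nlinarith [mul_le_mul_of_nonneg_left hn' (sq_nonneg (m : ℝ))]
  · nlinarith [mul_le_mul_of_nonneg_right (one_le_pow₀ hm' (n := 2)) (by positivity : (0 : ℝ) ≤ n)]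

lemma dyadicSumTwo_eq_sum (f : ℕ → ℕ → ℝ) {R : ℝ} {B : ℕ} (hB : ⌊2 * R⌋₊ ≤ B) :
    dyadicSumTwo f R = ∑ p ∈ range (B + 1) ×ˢ range (B + 1),
      if 1 ≤ p.1 ∧ 1 ≤ p.2 ∧ R ≤ (p.1 : ℝ) ^ 2 * (p.2 : ℝ) ∧
        (p.1 : ℝ) ^ 2 * (p.2 : ℝ) ≤ 2 * R then f p.1 p.2 else 0 := by
  refine tsum_eq_sum fun p hp => if_neg fun ⟨hm, hn, _, h⟩ => hp ?_
  have := le_floor_of_sq_mul_le hm hn h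
  simp only [mem_product, mem_range]
  omega

lemma dyadicSumThree_eq_sum (f : ℕ → ℕ → ℝ) {R : ℝ} {B : ℕ} (hB : ⌊2 * R⌋₊ ≤ B) :
    dyadicSumThree f R =
      ∑ q ∈ range (B + 1) ×ˢ (range (B + 1) ×ˢ range (B + 1)),
      if 1 ≤ q.1 ∧ 1 ≤ q.2.1 ∧ 1 ≤ q.2.2 ∧
        R ≤ (q.1 : ℝ) ^ 3 * (q.2.1 : ℝ) ^ 2 * (q.2.2 : ℝ) ∧
        (q.1 : ℝ) ^ 3 * (q.2.1 : ℝ) ^ 2 * (q.2.2 : ℝ) ≤ 2 * R then f q.2.1 q.2.2 else 0 := by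
  refine tsum_eq_sum fun q hq => if_neg fun ⟨hd, hm, hn, _, h⟩ => hq ?_
  have hd' : (1 : ℝ) ≤ q.1 := by exact_mod_cast hd
  have hm' : (1 : ℝ) ≤ q.2.1 := by exact_mod_cast hm
  have hn' : (1 : ℝ) ≤ q.2.2 := by exact_mod_cast hn
  have hmn : (1 : ℝ) ≤ (q.2.1 : ℝ) ^ 2 * q.2.2 := one_le_mul_of_one_le_of_one_le
    (one_le_pow₀ hm') hn'
  have h1 := le_floor_of_sq_mul_le hm hn (X := 2 * R) <| by
    refine le_trans ?_ h
    rw [mul_assoc]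
    exact le_mul_of_one_le_left (by positivity) (one_le_pow₀ hd')
  have h2 : q.1 ≤ ⌊2 * R⌋₊ := by
    refine Nat.le_floor (le_trans ?_ h)
    rw [mul_assoc]
    exact (le_self_pow₀ hd' (by norm_num)).trans (le_mul_of_one_le_right (by positivity) hmn)
  simp only [mem_product, mem_range]
  omega

/-- At most `X ^ (1/3)` positive integers have cube at most `X`. -/
lemma card_filter_cube_le (s : Finset ℕ) {X : ℝ} (hX : 0 ≤ X) :
    ((s.filter fun d : ℕ => 1 ≤ d ∧ (d : ℝ) ^ 3 ≤ X).card : ℝ) ≤ X ^ ((1 : ℝ) / 3) := by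
  have hsub : (s.filter fun d : ℕ => 1 ≤ d ∧ (d : ℝ) ^ 3 ≤ X) ⊆
      Icc 1 ⌊X ^ ((1 : ℝ) / 3)⌋₊ := by
    intro d hd
    obtain ⟨-, h1, h3⟩ := mem_filter.1 hd
    refine mem_Icc.2 ⟨h1, Nat.le_floor ?_⟩
    calc (d : ℝ) = ((d : ℝ) ^ 3) ^ ((1 : ℝ) / 3) := by
          rw [← Real.rpow_natCast, ← Real.rpow_mul (by positivity)]
          norm_num
      _ ≤ X ^ ((1 : ℝ) / 3) := Real.rpow_le_rpow (by positivity) h3 (by norm_num)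
  calc _ ≤ ((Icc 1 ⌊X ^ ((1 : ℝ) / 3)⌋₊).card : ℝ) := by exact_mod_cast card_le_card hsub
    _ ≤ X ^ ((1 : ℝ) / 3) := by
      rw [Nat.card_Icc, Nat.add_sub_cancel]
      exact Nat.floor_le (by positivity)

/-- Summing over `d` for fixed `(m, n)`, the value `m²n` lies in a dyadic interval. -/
lemma sum_cube_le_sum_dyadic {c N : ℝ} (hc : 0 ≤ c) (hN : 1 ≤ N) (s : Finset ℕ) (m n : ℕ) :
    (∑ d ∈ s, if 1 ≤ d ∧ 1 ≤ m ∧ 1 ≤ n ∧ N ≤ (d : ℝ) ^ 3 * (m : ℝ) ^ 2 * (n : ℝ) ∧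
        (d : ℝ) ^ 3 * (m : ℝ) ^ 2 * (n : ℝ) ≤ 2 * N then c else 0) ≤
      ∑ k ∈ range (Nat.log 2 ⌊2 * N⌋₊ + 1), (2 * N / 2 ^ k) ^ ((1 : ℝ) / 3) *
        if 1 ≤ m ∧ 1 ≤ n ∧ (2 : ℝ) ^ k ≤ (m : ℝ) ^ 2 * (n : ℝ) ∧
          (m : ℝ) ^ 2 * (n : ℝ) ≤ 2 * 2 ^ k then c else 0 := by
  have hnonneg : ∀ k ∈ range (Nat.log 2 ⌊2 * N⌋₊ + 1), 0 ≤
      (2 * N / 2 ^ k) ^ ((1 : ℝ) / 3) *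
        if 1 ≤ m ∧ 1 ≤ n ∧ (2 : ℝ) ^ k ≤ (m : ℝ) ^ 2 * (n : ℝ) ∧
          (m : ℝ) ^ 2 * (n : ℝ) ≤ 2 * 2 ^ k then c else 0 := fun k _ =>
    mul_nonneg (by positivity) (by split_ifs <;> simp [hc])
  by_cases hmn : 1 ≤ m ∧ 1 ≤ n ∧ (m : ℝ) ^ 2 * n ≤ 2 * N
  · obtain ⟨hm, hn, hr⟩ := hmn
    set r := m ^ 2 * n with hrdef
    have hr0 : r ≠ 0 := by positivity
    have hrc : (m : ℝ) ^ 2 * n = (r : ℝ) := by rw [hrdef]; push_cast; rfl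
    have hrpos : (0 : ℝ) < r := by exact_mod_cast Nat.pos_of_ne_zero hr0
    have hlow : (2 : ℝ) ^ Nat.log 2 r ≤ r := by exact_mod_cast Nat.pow_log_le_self 2 hr0
    have hupp : (r : ℝ) ≤ 2 * 2 ^ Nat.log 2 r := by
      have := (Nat.lt_pow_succ_log_self (b := 2) (by norm_num) r).le
      rw [pow_succ'] at this
      exact_mod_cast this
    have hmem : Nat.log 2 r ∈ range (Nat.log 2 ⌊2 * N⌋₊ + 1) :=
      mem_range.2 (Nat.lt_succ_of_le (Nat.log_mono_right (Nat.le_floor (hrc ▸ hr))))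
    refine le_trans ?_ (single_le_sum hnonneg hmem)
    rw [hrc, if_pos ⟨hm, hn, hlow, hupp⟩]
    calc _ ≤ ∑ d ∈ s, if 1 ≤ d ∧ (d : ℝ) ^ 3 ≤ 2 * N / r then c else 0 := by
          refine sum_le_sum fun d _ => ?_
          split_ifs with h1 h2
          · exact le_rfl
          · refine absurd ⟨h1.1, ?_⟩ h2
            rw [le_div_iff₀ hrpos, ← hrc, ← mul_assoc]
            exact h1.2.2.2.2
          · exact hc
          · exact le_rfl
      _ = (s.filter fun d : ℕ => 1 ≤ d ∧ (d : ℝ) ^ 3 ≤ 2 * N / r).card * c := by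
          rw [← sum_filter, sum_const, nsmul_eq_mul]
      _ ≤ (2 * N / r) ^ ((1 : ℝ) / 3) * c := by
          gcongr
          exact card_filter_cube_le s (by positivity)
      _ ≤ _ := by gcongr
  · refine le_trans (le_of_eq ?_) (sum_nonneg hnonneg)
    refine sum_eq_zero fun d _ => if_neg fun ⟨hd, hm, hn, _, h⟩ => hmn ⟨hm, hn, le_trans ?_ h⟩
    rw [mul_assoc]
    exact le_mul_of_one_le_left (by positivity) (one_le_pow₀ (by exact_mod_cast hd))

lemma two_pow_le_of_mem_range_log {N : ℝ} (hN : 1 ≤ N) {k : ℕ}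
    (hk : k ∈ range (Nat.log 2 ⌊2 * N⌋₊ + 1)) : (2 : ℝ) ^ k ≤ 2 * N := by
  have hfloor : ⌊2 * N⌋₊ ≠ 0 := (Nat.floor_pos.2 (by linarith)).ne'
  have h := (Nat.pow_le_pow_right (n := 2) (by norm_num) (mem_range_succ_iff.1 hk)).trans
    (Nat.pow_log_le_self 2 hfloor)
  calc (2 : ℝ) ^ k ≤ (⌊2 * N⌋₊ : ℝ) := by exact_mod_cast h
    _ ≤ 2 * N := Nat.floor_le (by linarith)

lemma dyadicSumThree_le_sum {f : ℕ → ℕ → ℝ} (hf : ∀ m n, 0 ≤ f m n) {N : ℝ} (hN : 1 ≤ N) :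
    dyadicSumThree f N ≤ ∑ k ∈ range (Nat.log 2 ⌊2 * N⌋₊ + 1),
      (2 * N / 2 ^ k) ^ ((1 : ℝ) / 3) * dyadicSumTwo f (2 ^ k) := by
  have hpow : ∀ k ∈ range (Nat.log 2 ⌊2 * N⌋₊ + 1), ⌊2 * (2 : ℝ) ^ k⌋₊ ≤ ⌊4 * N⌋₊ := by
    intro k hk
    have := two_pow_le_of_mem_range_log hN hk
    exact Nat.floor_mono (by linarith)
  rw [dyadicSumThree_eq_sum f (B := ⌊4 * N⌋₊) (Nat.floor_mono (by linarith)), sum_product_right]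
  refine (sum_le_sum fun p _ =>
    sum_cube_le_sum_dyadic (hf p.1 p.2) hN _ p.1 p.2).trans (le_of_eq ?_)
  rw [sum_comm]
  refine sum_congr rfl fun k hk => ?_
  rw [dyadicSumTwo_eq_sum f (hpow k hk), mul_sum]

lemma log_two_floor_add_one_le {N : ℝ} (hN : 1 ≤ N) :
    ((Nat.log 2 ⌊2 * N⌋₊ + 1 : ℕ) : ℝ) ≤ 2 * (1 + Real.log N) := by
  have h := two_pow_le_of_mem_range_log hN (self_mem_range_succ (Nat.log 2 ⌊2 * N⌋₊))
  have h' := Real.log_le_log (by positivity) h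
  rw [Real.log_pow, Real.log_mul (by norm_num) (by positivity)] at h'
  have hl := Real.log_two_gt_d9
  have hlogN := Real.log_nonneg hN
  push_cast
  by_contra! hlt
  nlinarith

/-- The squared norm `|∑_F b_F ω_F^{-1/2} λ_F(m,n)|²`. -/
noncomputable def sqNormCombination {𝓕 : Type*} [Fintype 𝓕] (ω : 𝓕 → ℝ)
    (lam : 𝓕 → ℕ → ℕ → ℂ) (b : 𝓕 → ℂ) (m n : ℕ) : ℝ :=
  ‖∑ F, b F * ((ω F ^ (-(1 : ℝ) / 2) : ℝ) : ℂ) * lam F m n‖ ^ 2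

section

variable {𝓕 : Type*} [Fintype 𝓕] (ω : 𝓕 → ℝ) (lam : 𝓕 → ℕ → ℕ → ℂ)

lemma sqNormCombination_nonneg (b : 𝓕 → ℂ) (m n : ℕ) : 0 ≤ sqNormCombination ω lam b m n :=
  sq_nonneg _

lemma sqNormCombination_le {b : 𝓕 → ℂ} (hb : ∑ F, ‖b F‖ ^ 2 = 1) (m n : ℕ) :
    sqNormCombination ω lam b m n ≤
      (∑ F, ‖((ω F ^ (-(1 : ℝ) / 2) : ℝ) : ℂ) * lam F m n‖) ^ 2 := by
  refine pow_le_pow_left₀ (norm_nonneg _) (norm_sum_le_of_le _ fun F _ => ?_) 2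
  have h1 : ‖b F‖ ^ 2 ≤ 1 := hb ▸ single_le_sum (f := fun F => ‖b F‖ ^ 2)
    (fun _ _ => by positivity) (mem_univ F)
  rw [mul_assoc, norm_mul]
  exact mul_le_of_le_one_left (norm_nonneg _) (by nlinarith [norm_nonneg (b F)])

lemma exists_dyadicSumTwo_le (X : ℝ) : ∃ K, 0 ≤ K ∧ ∀ b : {b : 𝓕 → ℂ // ∑ F, ‖b F‖ ^ 2 = 1},
    ∀ R ≤ X, dyadicSumTwo (sqNormCombination ω lam b.1) R ≤ K := by
  refine ⟨∑ p ∈ range (⌊2 * X⌋₊ + 1) ×ˢ range (⌊2 * X⌋₊ + 1),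
    (∑ F, ‖((ω F ^ (-(1 : ℝ) / 2) : ℝ) : ℂ) * lam F p.1 p.2‖) ^ 2,
    sum_nonneg fun _ _ => by positivity, fun b R hR => ?_⟩
  rw [dyadicSumTwo_eq_sum _ (Nat.floor_mono (by linarith : 2 * R ≤ 2 * X))]
  refine sum_le_sum fun p _ => ?_
  split_ifs
  · exact sqNormCombination_le ω lam b.2 _ _
  · positivity

lemma dyadicSumTwo_le_deltaTwo (b : {b : 𝓕 → ℂ // ∑ F, ‖b F‖ ^ 2 = 1}) (R : ℝ) :
    dyadicSumTwo (sqNormCombination ω lam b.1) R ≤ DeltaTwo 𝓕 ω lam R := by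
  obtain ⟨K, -, hK⟩ := exists_dyadicSumTwo_le ω lam R
  exact le_ciSup (f := fun b : {b : 𝓕 → ℂ // ∑ F, ‖b F‖ ^ 2 = 1} =>
    dyadicSumTwo (sqNormCombination ω lam b.1) R) ⟨K, by rintro _ ⟨b, rfl⟩; exact hK b R le_rfl⟩ b

lemma deltaTwo_nonneg (R : ℝ) : 0 ≤ DeltaTwo 𝓕 ω lam R :=
  Real.iSup_nonneg fun b => dyadicSumTwo_nonneg (sqNormCombination_nonneg ω lam b.1) R

lemma bddAbove_range_deltaTwo {N : ℝ} (hN : 0 ≤ N) :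
    BddAbove (Set.range fun R : {R : ℝ // 1 ≤ R ∧ R ≤ 2 * N} =>
      (N / R.1) ^ ((1 : ℝ) / 3) * DeltaTwo 𝓕 ω lam R.1) := by
  obtain ⟨K, hK0, hK⟩ := exists_dyadicSumTwo_le ω lam (2 * N)
  refine ⟨N ^ ((1 : ℝ) / 3) * K, ?_⟩
  rintro _ ⟨⟨R, h1, h2⟩, rfl⟩
  have hR : 0 < R := by linarith
  have hle : DeltaTwo 𝓕 ω lam R ≤ K := Real.iSup_le (fun b => hK b R h2) hK0
  exact mul_le_mul (Real.rpow_le_rpow (by positivity) (div_le_self hN h1) (by norm_num)) hle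
    (deltaTwo_nonneg ω lam R) (by positivity)

end

/-- There is an absolute constant `C > 0` such that for every finite
family with positive weights and arbitrary coefficients, and every `N ≥ 1`,
`Δ^{(3)}(N) ≤ C (1 + log N) · sup_{1 ≤ R ≤ 2N} (N/R)^{1/3} Δ^{(2)}(R)`. -/
theorem deltaThree_le_deltaTwo :
    ∃ C > (0 : ℝ), ∀ (𝓕 : Type) [Fintype 𝓕], ∀ ω : 𝓕 → ℝ, (∀ F, 0 < ω F) →
      ∀ (lam : 𝓕 → ℕ → ℕ → ℂ) (N : ℝ), 1 ≤ N →
        DeltaThree 𝓕 ω lam N ≤ C * (1 + Real.log N) *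
          ⨆ R : {R : ℝ // 1 ≤ R ∧ R ≤ 2 * N},
            (N / R.1) ^ ((1 : ℝ) / 3) * DeltaTwo 𝓕 ω lam R.1 := by
  refine ⟨4, by norm_num, fun 𝓕 _ ω _ lam N hN => ?_⟩
  set S := ⨆ R : {R : ℝ // 1 ≤ R ∧ R ≤ 2 * N},
    (N / R.1) ^ ((1 : ℝ) / 3) * DeltaTwo 𝓕 ω lam R.1
  have hlogN := Real.log_nonneg hN
  have hS0 : 0 ≤ S := Real.iSup_nonneg fun R => by
    have := deltaTwo_nonneg ω lam R.1
    have : 0 < R.1 := by linarith [R.2.1]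
    positivity
  refine Real.iSup_le (fun b => ?_) (by positivity)
  change dyadicSumThree (sqNormCombination ω lam b.1) N ≤ _
  have hterm : ∀ k ∈ range (Nat.log 2 ⌊2 * N⌋₊ + 1), (2 * N / 2 ^ k) ^ ((1 : ℝ) / 3) *
      dyadicSumTwo (sqNormCombination ω lam b.1) (2 ^ k) ≤ 2 * S := by
    intro k hk
    have hkS := le_ciSup (bddAbove_range_deltaTwo ω lam (by linarith : 0 ≤ N))
      ⟨2 ^ k, one_le_pow₀ (by norm_num), two_pow_le_of_mem_range_log hN hk⟩
    have h2 : (2 : ℝ) ^ ((1 : ℝ) / 3) ≤ 2 :=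
      Real.rpow_le_self_of_one_le (by norm_num) (by norm_num)
    rw [mul_div_assoc, Real.mul_rpow (by norm_num) (by positivity), mul_assoc]
    refine mul_le_mul h2 (le_trans ?_ hkS) (mul_nonneg (by positivity) (dyadicSumTwo_nonneg
      (sqNormCombination_nonneg ω lam b.1) _)) (by norm_num)
    exact mul_le_mul_of_nonneg_left (dyadicSumTwo_le_deltaTwo ω lam b _) (by positivity)
  calc _ ≤ _ := dyadicSumThree_le_sum (sqNormCombination_nonneg ω lam b.1) hN
    _ ≤ (range (Nat.log 2 ⌊2 * N⌋₊ + 1)).card • (2 * S) := sum_le_card_nsmul _ _ _ hterm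
    _ ≤ 2 * (1 + Real.log N) * (2 * S) := by
        rw [card_range, nsmul_eq_mul]
        exact mul_le_mul_of_nonneg_right (log_two_floor_add_one_le hN) (by positivity)
    _ = 4 * (1 + Real.log N) * S := by ring
end

section
/- Let 𝓕 be a finite set, ω : 𝓕 → ℝ with ω_F > 0, λ : 𝓕 → ℕ≥1 × ℕ≥1 → ℂ, K ≥ 1, and ε ∈ (0,1]. Assume: (i) λ_F(m,n) = ∑_{d | gcd(m,n)} μ(d) λ_F(m/d,1) λ_F(1,n/d) for all F ∈ 𝓕 and all positive integers m, n; (ii) λ_F(m,n) = conj(λ_F(n,m)) for all F ∈ 𝓕 and all m, n; (iii) ∑_{n ≤ X} |λ_F(1,n)|² ≤ K X^{1+ε} for all F ∈ 𝓕 and all real X ≥ 1. Then there exists a constant C depending only on ε such that for every real N ≥ 1, Δ^{(3)}(N) ≤ C K N^{5ε} · sup { (N/(XY²))^{1/3} · min( Y · Δ^{(1)}(X), X · Δ^{(1)}(Y) ) : X, Y real, X ≥ 1, Y ≥ 1, X Y² ≤ 4N }. -/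
open Finset

/-- The dual-side norm `Δ^{(1)}(R)`: supremum over unit vectors `b : 𝓕 → ℂ` of
`∑_{n : R ≤ n ≤ 2R} |∑_F b_F ω_F^{-1/2} λ_F(1,n)|²`, where `n` ranges over positive
integers. -/
noncomputable def DeltaOne (𝓕 : Type*) [Fintype 𝓕] (ω : 𝓕 → ℝ)
    (lam : 𝓕 → ℕ → ℕ → ℂ) (R : ℝ) : ℝ :=
  ⨆ b : {b : 𝓕 → ℂ // ∑ F, ‖b F‖ ^ 2 = 1},
    ∑' n : ℕ,
      if 1 ≤ n ∧ R ≤ (n : ℝ) ∧ (n : ℝ) ≤ 2 * R then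
        ‖∑ F, b.1 F * ((ω F ^ (-(1 : ℝ) / 2) : ℝ) : ℂ) * lam F 1 n‖ ^ 2
      else 0

theorem exists_card_divisors_le_rpow {ε : ℝ} (hε : 0 < ε) :
    ∃ C > (0 : ℝ), ∀ n : ℕ, n ≠ 0 → (#n.divisors : ℝ) ≤ C * (n : ℝ) ^ ε := by
  obtain ⟨P, hP⟩ := exists_nat_ge ((2 : ℝ) ^ (1 / ε))
  set c : ℝ := max 1 (1 / (ε * Real.log 2)) with hc
  have hlog : 0 < Real.log 2 := Real.log_pos one_lt_two
  have hc1 : 1 ≤ c := le_max_left _ _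
  have hsmall : ∀ p a : ℕ, p.Prime → ((a + 1 : ℕ) : ℝ) ≤ c * ((p ^ a : ℕ) : ℝ) ^ ε := by
    intro p a hp
    have h2 : (2 : ℝ) ≤ p := by exact_mod_cast hp.two_le
    have h3 : (a : ℝ) * ε * Real.log 2 + 1 ≤ ((p ^ a : ℕ) : ℝ) ^ ε := calc
      (a : ℝ) * ε * Real.log 2 + 1 ≤ Real.exp (a * ε * Real.log 2) := Real.add_one_le_exp _
      _ = ((2 : ℝ) ^ a) ^ ε := by
        rw [← Real.rpow_natCast, ← Real.rpow_mul (by norm_num), Real.rpow_def_of_pos (by norm_num)]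
        congr 1
        ring
      _ ≤ ((p ^ a : ℕ) : ℝ) ^ ε := by
        push_cast
        gcongr
    have h4 : (1 : ℝ) ≤ c * (ε * Real.log 2) := by
      have := le_max_right 1 (1 / (ε * Real.log 2))
      rw [← hc, div_le_iff₀ (by positivity)] at this
      exact this
    push_cast at h3 ⊢
    calc (a : ℝ) + 1 ≤ a * (c * (ε * Real.log 2)) + c := by nlinarith [Nat.cast_nonneg (α := ℝ) a]
      _ = c * (a * ε * Real.log 2 + 1) := by ring
      _ ≤ _ := by gcongr
  have hlarge : ∀ p a : ℕ, P ≤ p → ((a + 1 : ℕ) : ℝ) ≤ ((p ^ a : ℕ) : ℝ) ^ ε := by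
    intro p a hp
    have h1 : (2 : ℝ) ≤ (p : ℝ) ^ ε := calc
      (2 : ℝ) = ((2 : ℝ) ^ (1 / ε)) ^ ε := by
        rw [← Real.rpow_mul (by norm_num), one_div_mul_cancel hε.ne', Real.rpow_one]
      _ ≤ (p : ℝ) ^ ε := by
        have : (P : ℝ) ≤ p := by exact_mod_cast hp
        gcongr
        exact hP.trans this
    calc ((a + 1 : ℕ) : ℝ) ≤ ((2 ^ a : ℕ) : ℝ) := by exact_mod_cast Nat.lt_two_pow_self
      _ = (2 : ℝ) ^ a := by push_cast; rfl
      _ ≤ ((p : ℝ) ^ ε) ^ a := by gcongr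
      _ = ((p ^ a : ℕ) : ℝ) ^ ε := by
        push_cast
        rw [← Real.rpow_natCast, ← Real.rpow_natCast, ← Real.rpow_mul (by positivity),
          ← Real.rpow_mul (by positivity), mul_comm]
  refine ⟨c ^ P, by positivity, fun n hn => ?_⟩
  rw [Nat.card_divisors hn]
  push_cast
  have key : ∀ p ∈ n.primeFactors, ((n.factorization p : ℝ) + 1) ≤
      (if p < P then c else 1) * ((p ^ n.factorization p : ℕ) : ℝ) ^ ε := by
    intro p hp
    split_ifs with h
    · exact_mod_cast hsmall p _ (Nat.prime_of_mem_primeFactors hp)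
    · simpa using hlarge p (n.factorization p) (not_lt.1 h)
  calc ∏ p ∈ n.primeFactors, ((n.factorization p : ℝ) + 1)
      ≤ ∏ p ∈ n.primeFactors, (if p < P then c else 1) * ((p ^ n.factorization p : ℕ) : ℝ) ^ ε :=
        prod_le_prod (fun _ _ => by positivity) key
    _ = (∏ p ∈ n.primeFactors, if p < P then c else 1) * (n : ℝ) ^ ε := by
        rw [prod_mul_distrib, Real.finsetProd_rpow _ _ (fun _ _ => by positivity), ← Nat.cast_prod]
        congr 3
        exact Nat.prod_factorization_pow_eq_self hn
    _ ≤ c ^ P * (n : ℝ) ^ ε := by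
        gcongr
        rw [← prod_filter, prod_const]
        refine pow_le_pow_right₀ hc1 ?_
        calc #(n.primeFactors.filter (· < P)) ≤ #(range P) :=
              card_le_card fun p hp => mem_range.2 (mem_filter.1 hp).2
          _ = P := card_range P

theorem sum_Icc_ite_dvd_le {M δ : ℕ} (hδ : 1 ≤ δ) {g : ℕ → ℝ} (hg : ∀ m, 0 ≤ g m) :
    ∑ m ∈ Icc 1 M, (if δ ∣ m then g (m / δ) else 0) ≤ ∑ m ∈ Icc 1 M, g m := by
  rw [← sum_filter]
  have hinj : Set.InjOn (fun m => m / δ) ((Icc 1 M).filter (δ ∣ ·) : Finset ℕ) := by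
    intro a ha b hb hab
    simp only [coe_filter, Set.mem_ofPred_eq] at ha hb
    rw [← Nat.div_mul_cancel ha.2, ← Nat.div_mul_cancel hb.2]
    exact congrArg (· * δ) hab
  rw [← sum_image (f := g) hinj]
  refine sum_le_sum_of_subset_of_nonneg ?_ fun m _ _ => hg m
  intro k hk
  obtain ⟨m, hm, rfl⟩ := mem_image.1 hk
  obtain ⟨hm, hdvd⟩ := mem_filter.1 hm
  obtain ⟨h1, h2⟩ := mem_Icc.1 hm
  exact mem_Icc.2 ⟨Nat.div_pos (Nat.le_of_dvd h1 hdvd) hδ, (Nat.div_le_self _ _).trans h2⟩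

theorem sum_sum_ite_cube_le (M : ℕ) {Q x : ℝ} (hQ : 0 < Q) (hx : 0 ≤ x) :
    ∑ d ∈ Icc 1 M, ∑ e ∈ Icc 1 M, (if ((d : ℝ) * e) ^ 3 * Q ≤ x then (1 : ℝ) else 0) ≤
      (x / Q) ^ ((1 : ℝ) / 3) * (1 + Real.log M) := by
  set Z := (x / Q) ^ ((1 : ℝ) / 3)
  have hZ0 : 0 ≤ Z := by positivity
  have hZ3 : Z ^ 3 = x / Q := by
    rw [← Real.rpow_natCast, ← Real.rpow_mul (by positivity)]
    norm_num
  have hinner : ∀ d ∈ Icc 1 M,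
      ∑ e ∈ Icc 1 M, (if ((d : ℝ) * e) ^ 3 * Q ≤ x then (1 : ℝ) else 0) ≤ Z * (d : ℝ)⁻¹ := by
    intro d hd
    have hd0 : (0 : ℝ) < d := by exact_mod_cast (mem_Icc.1 hd).1
    rw [sum_boole]
    calc _ ≤ ((#(Icc 1 ⌊Z * (d : ℝ)⁻¹⌋₊) : ℕ) : ℝ) := by
          refine Nat.cast_le.2 (card_le_card fun e he => ?_)
          obtain ⟨he, hle⟩ := mem_filter.1 he
          refine mem_Icc.2 ⟨(mem_Icc.1 he).1, Nat.le_floor ?_⟩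
          rw [← le_div_iff₀ hQ, ← hZ3] at hle
          have := le_of_pow_le_pow_left₀ (by norm_num) hZ0 hle
          rw [← div_eq_mul_inv, le_div_iff₀ hd0]
          linarith
      _ ≤ Z * (d : ℝ)⁻¹ := by
          rw [Nat.card_Icc, Nat.add_sub_cancel]
          exact Nat.floor_le (by positivity)
  calc _ ≤ ∑ d ∈ Icc 1 M, Z * (d : ℝ)⁻¹ := sum_le_sum hinner
    _ = Z * ((harmonic M : ℚ) : ℝ) := by
        rw [← mul_sum, harmonic_eq_sum_Icc]
        push_cast
        rfl
    _ ≤ _ := by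
        gcongr
        exact harmonic_le_one_add_log M

theorem sum_Icc_eq_sum_dyadic (M : ℕ) (g : ℕ → ℝ) :
    ∑ m ∈ Icc 1 M, g m =
      ∑ i ∈ range (Nat.log 2 M + 1), ∑ m ∈ (Icc 1 M).filter (Nat.log 2 · = i), g m := by
  refine (sum_fiberwise_of_maps_to (fun m hm => mem_range.2 ?_) g).symm
  exact Nat.lt_succ_of_le (Nat.log_mono_right (mem_Icc.1 hm).2)

theorem two_pow_le_of_log_eq {m j : ℕ} (hm : 1 ≤ m) (hj : Nat.log 2 m = j) :
    (2 : ℝ) ^ j ≤ m ∧ (m : ℝ) ≤ 2 * 2 ^ j := by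
  subst hj
  constructor
  · exact_mod_cast Nat.pow_log_le_self 2 (by omega)
  · have := (Nat.lt_pow_succ_log_self one_lt_two m).le
    rw [pow_succ, mul_comm] at this
    exact_mod_cast this

theorem sum_ite_cube_le_sum_dyadic (M : ℕ) (x : ℝ) {A : ℕ → ℕ → ℝ} (hA : ∀ m n, 0 ≤ A m n) :
    ∑ d ∈ Icc 1 M, ∑ e ∈ Icc 1 M, ∑ m ∈ Icc 1 M, ∑ n ∈ Icc 1 M,
        (if ((d : ℝ) * e) ^ 3 * ((m : ℝ) ^ 2 * n) ≤ x then A m n else 0) ≤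
      ∑ j ∈ range (Nat.log 2 M + 1), ∑ i ∈ range (Nat.log 2 M + 1),
        (∑ d ∈ Icc 1 M, ∑ e ∈ Icc 1 M,
          (if ((d : ℝ) * e) ^ 3 * (2 ^ i * (2 ^ j) ^ 2) ≤ x then (1 : ℝ) else 0)) *
        ∑ m ∈ (Icc 1 M).filter (Nat.log 2 · = j), ∑ n ∈ (Icc 1 M).filter (Nat.log 2 · = i),
          A m n := by
  calc _ ≤ ∑ d ∈ Icc 1 M, ∑ e ∈ Icc 1 M, ∑ j ∈ range (Nat.log 2 M + 1),
        ∑ i ∈ range (Nat.log 2 M + 1),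
          (if ((d : ℝ) * e) ^ 3 * (2 ^ i * (2 ^ j) ^ 2) ≤ x then (1 : ℝ) else 0) *
          ∑ m ∈ (Icc 1 M).filter (Nat.log 2 · = j), ∑ n ∈ (Icc 1 M).filter (Nat.log 2 · = i),
            A m n := by
        refine sum_le_sum fun d _ => sum_le_sum fun e _ => ?_
        rw [sum_Icc_eq_sum_dyadic]
        refine sum_le_sum fun j _ => ?_
        simp_rw [sum_Icc_eq_sum_dyadic M fun n => if _ * (_ * (n : ℝ)) ≤ x then _ else (0 : ℝ)]
        rw [sum_comm]
        refine sum_le_sum fun i _ => ?_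
        simp_rw [mul_sum]
        refine sum_le_sum fun m hm => sum_le_sum fun n hn => ?_
        have hm := mem_filter.1 hm
        have hn := mem_filter.1 hn
        have hm2 := (two_pow_le_of_log_eq (mem_Icc.1 hm.1).1 hm.2).1
        have hn2 := (two_pow_le_of_log_eq (mem_Icc.1 hn.1).1 hn.2).1
        split_ifs with h1 h2 h2
        · rw [one_mul]
        · refine absurd (le_trans ?_ h1) h2
          rw [mul_comm ((2 : ℝ) ^ i)]
          gcongr
        · rw [one_mul]
          exact hA m n
        · rw [zero_mul]
    _ = _ := by
        simp_rw [sum_mul]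
        rw [sum_comm' (t' := Icc 1 M) (s' := fun _ => Icc 1 M) (by simp [and_comm])]
        simp_rw [sum_comm (s := Icc 1 M) (t := range (Nat.log 2 M + 1))]
        refine sum_congr rfl fun j _ => sum_congr rfl fun i _ => ?_
        rw [sum_comm]

theorem sum_ite_le_of_le_sum_divisors (M : ℕ) (x : ℝ) {D : ℝ} (hD : 0 ≤ D) {A T : ℕ → ℕ → ℝ}
    (hA : ∀ m n, 0 ≤ A m n)
    (hT : ∀ m ∈ Icc 1 M, ∀ n ∈ Icc 1 M,
      T m n ≤ D * ∑ e ∈ (Nat.gcd m n).divisors, A (m / e) (n / e)) :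
    ∑ d ∈ Icc 1 M, ∑ m ∈ Icc 1 M, ∑ n ∈ Icc 1 M,
        (if (d : ℝ) ^ 3 * (m : ℝ) ^ 2 * n ≤ x then T m n else 0) ≤
      D * ∑ d ∈ Icc 1 M, ∑ e ∈ Icc 1 M, ∑ m ∈ Icc 1 M, ∑ n ∈ Icc 1 M,
        (if ((d : ℝ) * e) ^ 3 * ((m : ℝ) ^ 2 * n) ≤ x then A m n else 0) := by
  set G : ℕ → ℕ → ℕ → ℕ → ℝ := fun d e m n =>
    if ((d : ℝ) * e) ^ 3 * ((m : ℝ) ^ 2 * n) ≤ x then A m n else 0 with hG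
  have hG0 : ∀ d e m n, 0 ≤ G d e m n := fun d e m n => by
    simp only [hG]
    split_ifs
    exacts [hA m n, le_rfl]
  rw [mul_sum]
  refine sum_le_sum fun d _ => ?_
  calc _ ≤ ∑ m ∈ Icc 1 M, ∑ n ∈ Icc 1 M, D * ∑ e ∈ Icc 1 M,
        (if e ∣ m then if e ∣ n then G d e (m / e) (n / e) else 0 else 0) := by
        refine sum_le_sum fun m hm => sum_le_sum fun n hn => ?_
        split_ifs with h
        · refine (hT m hm n hn).trans (mul_le_mul_of_nonneg_left ?_ hD)
          simp_rw [← ite_and]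
          rw [← sum_filter]
          obtain ⟨hm1, hm2⟩ := mem_Icc.1 hm
          have hgcd : 0 < Nat.gcd m n := Nat.gcd_pos_of_pos_left _ hm1
          have hset : (Icc 1 M).filter (fun e => e ∣ m ∧ e ∣ n) = (Nat.gcd m n).divisors := by
            ext e
            simp only [mem_filter, mem_Icc, Nat.mem_divisors, Nat.dvd_gcd_iff]
            constructor
            · exact fun he => ⟨he.2, hgcd.ne'⟩
            · exact fun he => ⟨⟨Nat.pos_of_dvd_of_pos he.1.1 hm1,
                (Nat.le_of_dvd hm1 he.1.1).trans hm2⟩, he.1⟩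
          rw [hset]
          refine sum_le_sum fun e he => le_of_eq ?_
          obtain ⟨⟨⟨k, hk⟩, ⟨l, hl⟩⟩, -⟩ := by
            simpa only [Nat.mem_divisors, Nat.dvd_gcd_iff] using he
          have he0 : 0 < e := Nat.pos_of_mem_divisors he
          simp only [hG]
          rw [if_pos]
          subst hk hl
          rw [Nat.mul_div_cancel_left _ he0, Nat.mul_div_cancel_left _ he0]
          refine le_trans (le_of_eq ?_) h
          push_cast
          ring
        · refine mul_nonneg hD (sum_nonneg fun e _ => ?_)
          split_ifs
          exacts [hG0 _ _ _ _, le_rfl, le_rfl]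
    _ = D * ∑ e ∈ Icc 1 M, ∑ m ∈ Icc 1 M, (if e ∣ m then
          ∑ n ∈ Icc 1 M, if e ∣ n then G d e (m / e) (n / e) else 0 else 0) := by
        simp_rw [← mul_sum]
        congr 1
        refine ((sum_congr rfl fun m _ => sum_comm).trans sum_comm).trans ?_
        refine sum_congr rfl fun e _ => sum_congr rfl fun m _ => ?_
        split_ifs
        exacts [rfl, sum_const_zero]
    _ ≤ D * ∑ e ∈ Icc 1 M, ∑ m ∈ Icc 1 M, ∑ n ∈ Icc 1 M, G d e m n := by
        refine mul_le_mul_of_nonneg_left (sum_le_sum fun e he => ?_) hD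
        have he1 := (mem_Icc.1 he).1
        refine le_trans (sum_le_sum fun m _ => ?_)
          (sum_Icc_ite_dvd_le he1 fun m => sum_nonneg fun n _ => hG0 d e m n)
        split_ifs
        · exact sum_Icc_ite_dvd_le he1 (hG0 d e (m / e))
        · rfl

theorem log_two_mul_le {ε N : ℝ} (hε0 : 0 < ε) (hε1 : ε ≤ 1) (hN : 1 ≤ N) :
    Real.log (2 * N) ≤ 2 / ε * N ^ ε := by
  refine (Real.log_le_rpow_div (by positivity) hε0).trans ?_
  rw [Real.mul_rpow (by norm_num) (by positivity), div_mul_eq_mul_div]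
  gcongr
  exact Real.rpow_le_self_of_one_le (by norm_num) hε1

theorem one_add_log_floor_le {ε N : ℝ} (hε0 : 0 < ε) (hε1 : ε ≤ 1) (hN : 1 ≤ N) :
    1 + Real.log (⌊2 * N⌋₊ : ℝ) ≤ (1 + 2 / ε) * N ^ ε := by
  have h1 : (1 : ℝ) ≤ N ^ ε := Real.one_le_rpow hN hε0.le
  have h2 : Real.log (⌊2 * N⌋₊ : ℝ) ≤ Real.log (2 * N) := by
    refine Real.log_le_log ?_ (Nat.floor_le (by positivity))
    exact_mod_cast Nat.floor_pos.2 (by linarith)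
  linarith [log_two_mul_le hε0 hε1 hN]

theorem natLog_floor_add_one_le {ε N : ℝ} (hε0 : 0 < ε) (hε1 : ε ≤ 1) (hN : 1 ≤ N) :
    ((Nat.log 2 ⌊2 * N⌋₊ + 1 : ℕ) : ℝ) ≤ 2 * (1 + 2 / ε) * N ^ ε := by
  have h := Real.natLog_le_logb ⌊2 * N⌋₊ 2
  have h2 : (1 : ℝ) ≤ ⌊2 * N⌋₊ := by exact_mod_cast Nat.floor_pos.2 (by linarith)
  have h3 : Real.logb 2 (⌊2 * N⌋₊ : ℝ) ≤ 2 * Real.log (⌊2 * N⌋₊ : ℝ) := by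
    rw [Real.logb, div_le_iff₀ (Real.log_pos one_lt_two)]
    nlinarith [Real.log_two_gt_d9, Real.log_nonneg h2]
  push_cast at h ⊢
  linarith [one_add_log_floor_le hε0 hε1 hN]

section DeltaOne

variable {𝓕 : Type*} [Fintype 𝓕] {ω : 𝓕 → ℝ} {lam : 𝓕 → ℕ → ℕ → ℂ}

theorem norm_sum_mul_sq_le (c a : 𝓕 → ℂ) :
    ‖∑ F, c F * a F‖ ^ 2 ≤ (∑ F, ‖c F‖ ^ 2) * ∑ F, ‖a F‖ ^ 2 := calc
  ‖∑ F, c F * a F‖ ^ 2 ≤ (∑ F, ‖c F‖ * ‖a F‖) ^ 2 := by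
    gcongr
    exact (norm_sum_le _ _).trans_eq (by simp only [norm_mul])
  _ ≤ _ := sum_mul_sq_le_sq_mul_sq _ _ _

theorem deltaOne_nonneg (R : ℝ) : 0 ≤ DeltaOne 𝓕 ω lam R :=
  Real.iSup_nonneg fun _ => tsum_nonneg fun _ => by split_ifs <;> positivity

theorem tsum_deltaOne_eq_sum (b : 𝓕 → ℂ) {R : ℝ} {M : ℕ} (hM : 2 * R ≤ M) :
    (∑' n : ℕ, if 1 ≤ n ∧ R ≤ (n : ℝ) ∧ (n : ℝ) ≤ 2 * R then
        ‖∑ F, b F * ((ω F ^ (-(1 : ℝ) / 2) : ℝ) : ℂ) * lam F 1 n‖ ^ 2 else 0) =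
      ∑ n ∈ Icc 1 M, if 1 ≤ n ∧ R ≤ (n : ℝ) ∧ (n : ℝ) ≤ 2 * R then
        ‖∑ F, b F * ((ω F ^ (-(1 : ℝ) / 2) : ℝ) : ℂ) * lam F 1 n‖ ^ 2 else 0 := by
  refine tsum_eq_sum fun n hn => if_neg fun h => hn (mem_Icc.2 ⟨h.1, ?_⟩)
  exact_mod_cast h.2.2.trans hM

theorem tsum_deltaOne_le {b : 𝓕 → ℂ} (hb : ∑ F, ‖b F‖ ^ 2 = 1) {R : ℝ} {M : ℕ} (hM : 2 * R ≤ M) :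
    (∑' n : ℕ, if 1 ≤ n ∧ R ≤ (n : ℝ) ∧ (n : ℝ) ≤ 2 * R then
        ‖∑ F, b F * ((ω F ^ (-(1 : ℝ) / 2) : ℝ) : ℂ) * lam F 1 n‖ ^ 2 else 0) ≤
      ∑ n ∈ Icc 1 M, ∑ F, ‖((ω F ^ (-(1 : ℝ) / 2) : ℝ) : ℂ) * lam F 1 n‖ ^ 2 := by
  rw [tsum_deltaOne_eq_sum b hM]
  refine sum_le_sum fun n _ => ?_
  split_ifs
  · simpa only [mul_assoc, hb, one_mul] using
      norm_sum_mul_sq_le b fun F => ((ω F ^ (-(1 : ℝ) / 2) : ℝ) : ℂ) * lam F 1 n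
  · positivity

theorem deltaOne_le {R : ℝ} {M : ℕ} (hM : 2 * R ≤ M) :
    DeltaOne 𝓕 ω lam R ≤
      ∑ n ∈ Icc 1 M, ∑ F, ‖((ω F ^ (-(1 : ℝ) / 2) : ℝ) : ℂ) * lam F 1 n‖ ^ 2 :=
  Real.iSup_le (fun b => tsum_deltaOne_le b.2 hM) (by positivity)

theorem sum_le_deltaOne_mul (c : 𝓕 → ℂ) {R : ℝ} {s : Finset ℕ}
    (hs : ∀ n ∈ s, 1 ≤ n ∧ R ≤ (n : ℝ) ∧ (n : ℝ) ≤ 2 * R) :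
    ∑ n ∈ s, ‖∑ F, c F * ((ω F ^ (-(1 : ℝ) / 2) : ℝ) : ℂ) * lam F 1 n‖ ^ 2 ≤
      DeltaOne 𝓕 ω lam R * ∑ F, ‖c F‖ ^ 2 := by
  obtain ⟨M, hM⟩ := exists_nat_ge (2 * R)
  have hunit : ∀ b : 𝓕 → ℂ, ∑ F, ‖b F‖ ^ 2 = 1 →
      ∑ n ∈ s, ‖∑ F, b F * ((ω F ^ (-(1 : ℝ) / 2) : ℝ) : ℂ) * lam F 1 n‖ ^ 2 ≤
        DeltaOne 𝓕 ω lam R := by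
    intro b hb
    refine le_trans ?_ (le_ciSup (f := fun b : {b : 𝓕 → ℂ // ∑ F, ‖b F‖ ^ 2 = 1} =>
      ∑' n : ℕ, if 1 ≤ n ∧ R ≤ (n : ℝ) ∧ (n : ℝ) ≤ 2 * R then
        ‖∑ F, b.1 F * ((ω F ^ (-(1 : ℝ) / 2) : ℝ) : ℂ) * lam F 1 n‖ ^ 2 else 0) ?_ ⟨b, hb⟩)
    · rw [tsum_deltaOne_eq_sum b hM]
      calc _ = ∑ n ∈ s, if 1 ≤ n ∧ R ≤ (n : ℝ) ∧ (n : ℝ) ≤ 2 * R then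
              ‖∑ F, b F * ((ω F ^ (-(1 : ℝ) / 2) : ℝ) : ℂ) * lam F 1 n‖ ^ 2 else 0 :=
            sum_congr rfl fun n hn => (if_pos (hs n hn)).symm
        _ ≤ _ := by
            refine sum_le_sum_of_subset_of_nonneg (fun n hn => mem_Icc.2 ⟨(hs n hn).1, ?_⟩)
              fun n _ _ => by split_ifs <;> positivity
            exact_mod_cast (hs n hn).2.2.trans hM
    · exact ⟨_, Set.forall_mem_range.2 fun b => tsum_deltaOne_le b.2 hM⟩
  set t := ∑ F, ‖c F‖ ^ 2 with ht
  have ht0 : 0 ≤ t := by positivity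
  rcases ht0.eq_or_lt with h0 | hpos
  · have hc : ∀ F, c F = 0 := fun F => by
      have := (sum_eq_zero_iff_of_nonneg (fun F _ => by positivity)).1 (ht.symm.trans h0.symm) F
        (mem_univ F)
      simpa using this
    simp [hc, ← h0]
  · have hsq : √t ^ 2 = t := Real.sq_sqrt ht0
    have h := hunit (fun F => ((√t)⁻¹ : ℝ) * c F) (by
      simp only [norm_mul, mul_pow, ← mul_sum, Complex.norm_real, norm_inv, inv_pow,
        Real.norm_eq_abs, sq_abs, hsq]
      exact inv_mul_cancel₀ hpos.ne')
    simp only [mul_assoc, ← mul_sum] at h ⊢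
    simp only [norm_mul, mul_pow, ← mul_sum, Complex.norm_real, norm_inv, inv_pow,
        Real.norm_eq_abs, sq_abs, hsq] at h
    rwa [inv_mul_le_iff₀ hpos, mul_comm t] at h

theorem sum_sum_norm_sq_le {K ε X Y : ℝ} {b : 𝓕 → ℂ} (hb : ∑ F, ‖b F‖ ^ 2 = 1)
    (hlam : ∀ (F : 𝓕) (X : ℝ), 1 ≤ X →
      ∑ n ∈ Icc 1 (Nat.floor X), ‖lam F 1 n‖ ^ 2 ≤ K * X ^ (1 + ε))
    (hY : 1 ≤ Y) {s t : Finset ℕ}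
    (hs : ∀ n ∈ s, 1 ≤ n ∧ X ≤ (n : ℝ) ∧ (n : ℝ) ≤ 2 * X)
    (ht : ∀ m ∈ t, 1 ≤ m ∧ (m : ℝ) ≤ 2 * Y) :
    ∑ m ∈ t, ∑ n ∈ s, ‖∑ F, b F * ((ω F ^ (-(1 : ℝ) / 2) : ℝ) : ℂ) *
        ((starRingEnd ℂ) (lam F 1 m) * lam F 1 n)‖ ^ 2 ≤
      DeltaOne 𝓕 ω lam X * (K * (2 * Y) ^ (1 + ε)) := by
  have hm : ∀ m ∈ t, ∑ n ∈ s, ‖∑ F, b F * ((ω F ^ (-(1 : ℝ) / 2) : ℝ) : ℂ) *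
        ((starRingEnd ℂ) (lam F 1 m) * lam F 1 n)‖ ^ 2 ≤
      DeltaOne 𝓕 ω lam X * ∑ F, ‖b F‖ ^ 2 * ‖lam F 1 m‖ ^ 2 := by
    intro m _
    have h := sum_le_deltaOne_mul (ω := ω) (lam := lam)
      (fun F => b F * (starRingEnd ℂ) (lam F 1 m)) hs
    simp only [norm_mul, mul_pow, RCLike.norm_conj] at h
    refine le_trans (le_of_eq ?_) h
    refine sum_congr rfl fun n _ => ?_
    congr 2
    exact sum_congr rfl fun F _ => by ring
  calc _ ≤ ∑ m ∈ t, DeltaOne 𝓕 ω lam X * ∑ F, ‖b F‖ ^ 2 * ‖lam F 1 m‖ ^ 2 := sum_le_sum hm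
    _ = DeltaOne 𝓕 ω lam X * ∑ F, ‖b F‖ ^ 2 * ∑ m ∈ t, ‖lam F 1 m‖ ^ 2 := by
      rw [← mul_sum, sum_comm]
      simp only [mul_sum]
    _ ≤ DeltaOne 𝓕 ω lam X * ∑ F, ‖b F‖ ^ 2 * (K * (2 * Y) ^ (1 + ε)) := by
      refine mul_le_mul_of_nonneg_left (sum_le_sum fun F _ => ?_) (deltaOne_nonneg X)
      refine mul_le_mul_of_nonneg_left (le_trans ?_ (hlam F (2 * Y) (by linarith))) (by positivity)
      refine sum_le_sum_of_subset_of_nonneg (fun m hm => ?_) fun _ _ _ => by positivity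
      exact mem_Icc.2 ⟨(ht m hm).1, Nat.le_floor (ht m hm).2⟩
    _ = _ := by rw [← sum_mul, hb, one_mul]

theorem sum_sum_norm_sq_le_min {K ε X Y : ℝ} {b : 𝓕 → ℂ} (hb : ∑ F, ‖b F‖ ^ 2 = 1)
    (hlam : ∀ (F : 𝓕) (X : ℝ), 1 ≤ X →
      ∑ n ∈ Icc 1 (Nat.floor X), ‖lam F 1 n‖ ^ 2 ≤ K * X ^ (1 + ε))
    (hX : 1 ≤ X) (hY : 1 ≤ Y) {s t : Finset ℕ}
    (hs : ∀ n ∈ s, 1 ≤ n ∧ X ≤ (n : ℝ) ∧ (n : ℝ) ≤ 2 * X)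
    (ht : ∀ m ∈ t, 1 ≤ m ∧ Y ≤ (m : ℝ) ∧ (m : ℝ) ≤ 2 * Y) :
    ∑ m ∈ t, ∑ n ∈ s, ‖∑ F, b F * ((ω F ^ (-(1 : ℝ) / 2) : ℝ) : ℂ) *
        ((starRingEnd ℂ) (lam F 1 m) * lam F 1 n)‖ ^ 2 ≤
      min (DeltaOne 𝓕 ω lam X * (K * (2 * Y) ^ (1 + ε)))
        (DeltaOne 𝓕 ω lam Y * (K * (2 * X) ^ (1 + ε))) := by
  refine le_min (sum_sum_norm_sq_le hb hlam hY hs fun m hm => ⟨(ht m hm).1, (ht m hm).2.2⟩) ?_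
  have h := sum_sum_norm_sq_le (ω := ω) (b := fun F => (starRingEnd ℂ) (b F))
    (by simpa only [RCLike.norm_conj] using hb) hlam hX ht
    fun n hn => ⟨(hs n hn).1, (hs n hn).2.2⟩
  rw [sum_comm] at h
  refine le_trans (le_of_eq (sum_congr rfl fun m _ => sum_congr rfl fun n _ => ?_)) h
  rw [← RCLike.norm_conj]
  simp only [map_sum, map_mul, Complex.conj_ofReal, Complex.conj_conj]
  congr 2
  exact sum_congr rfl fun F _ => by ring

theorem norm_sum_hecke_sq_le (b : 𝓕 → ℂ)
    (hhecke : ∀ (F : 𝓕) (m n : ℕ), 0 < m → 0 < n →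
      lam F m n = ∑ d ∈ (Nat.gcd m n).divisors,
        ((ArithmeticFunction.moebius d : ℤ) : ℂ) * lam F (m / d) 1 * lam F 1 (n / d))
    (hdual : ∀ (F : 𝓕) (m n : ℕ), 0 < m → 0 < n →
      lam F m n = (starRingEnd ℂ) (lam F n m)) {m n : ℕ} (hm : 0 < m) (hn : 0 < n) :
    ‖∑ F, b F * ((ω F ^ (-(1 : ℝ) / 2) : ℝ) : ℂ) * lam F m n‖ ^ 2 ≤
      #(Nat.gcd m n).divisors * ∑ d ∈ (Nat.gcd m n).divisors,
        ‖∑ F, b F * ((ω F ^ (-(1 : ℝ) / 2) : ℝ) : ℂ) *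
          ((starRingEnd ℂ) (lam F 1 (m / d)) * lam F 1 (n / d))‖ ^ 2 := by
  have heq : ∑ F, b F * ((ω F ^ (-(1 : ℝ) / 2) : ℝ) : ℂ) * lam F m n =
      ∑ d ∈ (Nat.gcd m n).divisors, ((ArithmeticFunction.moebius d : ℤ) : ℂ) *
        ∑ F, b F * ((ω F ^ (-(1 : ℝ) / 2) : ℝ) : ℂ) *
          ((starRingEnd ℂ) (lam F 1 (m / d)) * lam F 1 (n / d)) := by
    simp_rw [mul_sum]
    rw [sum_comm]
    refine sum_congr rfl fun F _ => ?_
    rw [hhecke F m n hm hn, mul_sum]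
    refine sum_congr rfl fun d hd => ?_
    have hdm : d ∣ m := (Nat.dvd_of_mem_divisors hd).trans (Nat.gcd_dvd_left m n)
    rw [hdual F (m / d) 1 (Nat.div_pos (Nat.le_of_dvd hm hdm) (Nat.pos_of_mem_divisors hd))
      one_pos]
    ring
  rw [heq]
  refine le_trans ?_ (sq_sum_le_card_mul_sum_sq (s := (Nat.gcd m n).divisors))
  gcongr
  refine (norm_sum_le _ _).trans (sum_le_sum fun d _ => ?_)
  rw [norm_mul, Complex.norm_intCast]
  refine mul_le_of_le_one_left (norm_nonneg _) ?_
  exact_mod_cast ArithmeticFunction.abs_moebius_le_one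

theorem tsum_deltaThree_le_sum (b : 𝓕 → ℂ) (N : ℝ) :
    (∑' q : ℕ × ℕ × ℕ,
      if 1 ≤ q.1 ∧ 1 ≤ q.2.1 ∧ 1 ≤ q.2.2 ∧
          N ≤ (q.1 : ℝ) ^ 3 * (q.2.1 : ℝ) ^ 2 * (q.2.2 : ℝ) ∧
          (q.1 : ℝ) ^ 3 * (q.2.1 : ℝ) ^ 2 * (q.2.2 : ℝ) ≤ 2 * N then
        ‖∑ F, b F * ((ω F ^ (-(1 : ℝ) / 2) : ℝ) : ℂ) * lam F q.2.1 q.2.2‖ ^ 2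
      else 0) ≤
    ∑ d ∈ Icc 1 ⌊2 * N⌋₊, ∑ m ∈ Icc 1 ⌊2 * N⌋₊, ∑ n ∈ Icc 1 ⌊2 * N⌋₊,
      if (d : ℝ) ^ 3 * (m : ℝ) ^ 2 * n ≤ 2 * N then
        ‖∑ F, b F * ((ω F ^ (-(1 : ℝ) / 2) : ℝ) : ℂ) * lam F m n‖ ^ 2 else 0 := by
  rw [tsum_eq_sum (s := Icc 1 ⌊2 * N⌋₊ ×ˢ Icc 1 ⌊2 * N⌋₊ ×ˢ Icc 1 ⌊2 * N⌋₊), sum_product]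
  · refine sum_le_sum fun d _ => ?_
    rw [sum_product]
    refine sum_le_sum fun m _ => sum_le_sum fun n _ => ?_
    split_ifs with h1 h2 h2
    · rfl
    · exact absurd h1.2.2.2.2 h2
    · positivity
    · rfl
  · rintro ⟨d, m, n⟩ hq
    refine if_neg fun ⟨hd, hm, hn, _, h⟩ => hq ?_
    simp only [mem_product, mem_Icc]
    dsimp only at hd hm hn h
    have h' : d ^ 3 * m ^ 2 * n ≤ ⌊2 * N⌋₊ := Nat.le_floor (by exact_mod_cast h)
    have hd1 : d ≤ d ^ 3 := Nat.le_self_pow (by norm_num) d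
    have hm1 : m ≤ m ^ 2 := Nat.le_self_pow (by norm_num) m
    have hd3 : 1 ≤ d ^ 3 := Nat.one_le_pow _ _ hd
    have hm2 : 1 ≤ m ^ 2 := Nat.one_le_pow _ _ hm
    refine ⟨⟨hd, ?_⟩, ⟨hm, ?_⟩, hn, ?_⟩
    · calc d ≤ d ^ 3 * 1 * 1 := by omega
        _ ≤ d ^ 3 * m ^ 2 * n := by gcongr
        _ ≤ _ := h'
    · calc m ≤ 1 * m ^ 2 * 1 := by omega
        _ ≤ d ^ 3 * m ^ 2 * n := by gcongr
        _ ≤ _ := h'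
    · calc n = 1 * 1 * n := by omega
        _ ≤ d ^ 3 * m ^ 2 * n := by gcongr
        _ ≤ _ := h'

theorem bddAbove_range_mul_min_deltaOne {N : ℝ} (hN : 0 ≤ N) :
    BddAbove (Set.range fun p : {p : ℝ × ℝ // 1 ≤ p.1 ∧ 1 ≤ p.2 ∧ p.1 * p.2 ^ 2 ≤ 4 * N} =>
      (N / (p.1.1 * p.1.2 ^ 2)) ^ ((1 : ℝ) / 3) *
        min (p.1.2 * DeltaOne 𝓕 ω lam p.1.1) (p.1.1 * DeltaOne 𝓕 ω lam p.1.2)) := by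
  obtain ⟨M, hM⟩ := exists_nat_ge (2 * (4 * N))
  refine ⟨N ^ ((1 : ℝ) / 3) * (4 * N *
    ∑ n ∈ Icc 1 M, ∑ F, ‖((ω F ^ (-(1 : ℝ) / 2) : ℝ) : ℂ) * lam F 1 n‖ ^ 2), ?_⟩
  rintro _ ⟨⟨⟨X, Y⟩, hX, hY, hXY⟩, rfl⟩
  dsimp only at hX hY hXY ⊢
  have hY2 : Y ≤ Y ^ 2 := le_self_pow₀ hY (by norm_num)
  have hX4 : X ≤ 4 * N := by nlinarith
  have hY4 : Y ≤ 4 * N := by nlinarith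
  have hmin := deltaOne_nonneg (ω := ω) (lam := lam) X
  refine mul_le_mul ?_ ((min_le_left _ _).trans ?_) ?_ (by positivity)
  · gcongr
    exact div_le_self hN (by nlinarith)
  · refine mul_le_mul hY4 (deltaOne_le (le_trans ?_ hM)) hmin (by positivity)
    linarith
  · exact le_min (mul_nonneg (by linarith) hmin) (mul_nonneg (by linarith) (deltaOne_nonneg Y))

theorem two_mul_rpow_one_add_le {ε Y N : ℝ} (hε0 : 0 ≤ ε) (hε1 : ε ≤ 1) (hY : 0 < Y)
    (hYN : Y ≤ 2 * N) : (2 * Y) ^ (1 + ε) ≤ 8 * N ^ ε * Y := by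
  have hN : 0 < N := by linarith
  rw [Real.rpow_add (by positivity), Real.rpow_one]
  have h1 : (2 * Y) ^ ε ≤ 4 * N ^ ε := calc
    (2 * Y) ^ ε ≤ (4 * N) ^ ε := Real.rpow_le_rpow (by positivity) (by linarith) hε0
    _ = 4 ^ ε * N ^ ε := Real.mul_rpow (by norm_num) hN.le
    _ ≤ 4 * N ^ ε := by
      gcongr
      exact Real.rpow_le_self_of_one_le (by norm_num) hε1
  calc 2 * Y * (2 * Y) ^ ε ≤ 2 * Y * (4 * N ^ ε) := by gcongr
    _ = 8 * N ^ ε * Y := by ring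

end DeltaOne

/-- Under the Hecke relation, Hecke duality, and the convexity-type
bound on `∑_{n ≤ X} |λ_F(1,n)|²`, one has
`Δ^{(3)}(N) ≤ C K N^{5ε} · sup { (N/(XY²))^{1/3} min(Y·Δ^{(1)}(X), X·Δ^{(1)}(Y)) :
X,Y ≥ 1, XY² ≤ 4N }`, with `C` depending only on `ε`. -/
theorem deltaThree_le_deltaOne (ε : ℝ) (hε0 : 0 < ε) (hε1 : ε ≤ 1) :
    ∃ C > (0 : ℝ), ∀ (𝓕 : Type) [Fintype 𝓕], ∀ ω : 𝓕 → ℝ, (∀ F, 0 < ω F) →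
      ∀ (lam : 𝓕 → ℕ → ℕ → ℂ) (K : ℝ), 1 ≤ K →
      (∀ (F : 𝓕) (m n : ℕ), 0 < m → 0 < n →
        lam F m n = ∑ d ∈ (Nat.gcd m n).divisors,
          ((ArithmeticFunction.moebius d : ℤ) : ℂ) * lam F (m / d) 1 * lam F 1 (n / d)) →
      (∀ (F : 𝓕) (m n : ℕ), 0 < m → 0 < n →
        lam F m n = (starRingEnd ℂ) (lam F n m)) →
      (∀ (F : 𝓕) (X : ℝ), 1 ≤ X →
        ∑ n ∈ Finset.Icc 1 (Nat.floor X), ‖lam F 1 n‖ ^ 2 ≤ K * X ^ (1 + ε)) →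
      ∀ N : ℝ, 1 ≤ N →
        DeltaThree 𝓕 ω lam N ≤ C * K * N ^ (5 * ε) *
          ⨆ p : {p : ℝ × ℝ // 1 ≤ p.1 ∧ 1 ≤ p.2 ∧ p.1 * p.2 ^ 2 ≤ 4 * N},
            (N / (p.1.1 * p.1.2 ^ 2)) ^ ((1 : ℝ) / 3) *
              min (p.1.2 * DeltaOne 𝓕 ω lam p.1.1)
                  (p.1.1 * DeltaOne 𝓕 ω lam p.1.2) := by

  obtain ⟨c, hc, hdiv⟩ := exists_card_divisors_le_rpow hε0
  refine ⟨2 * c * (2 * (1 + 2 / ε)) ^ 2 * (1 + 2 / ε) * 16, by positivity, ?_⟩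
  intro 𝓕 _ ω _ lam K hK hhecke hdual hlam N hN
  set S := ⨆ p : {p : ℝ × ℝ // 1 ≤ p.1 ∧ 1 ≤ p.2 ∧ p.1 * p.2 ^ 2 ≤ 4 * N},
    (N / (p.1.1 * p.1.2 ^ 2)) ^ ((1 : ℝ) / 3) *
      min (p.1.2 * DeltaOne 𝓕 ω lam p.1.1) (p.1.1 * DeltaOne 𝓕 ω lam p.1.2) with hS
  have hN0 : 0 < N := by linarith
  have hS0 : 0 ≤ S := Real.iSup_nonneg fun ⟨⟨X, Y⟩, hX, hY, _⟩ => by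
    dsimp only at hX hY ⊢
    have h1 := deltaOne_nonneg (ω := ω) (lam := lam) X
    have h2 := deltaOne_nonneg (ω := ω) (lam := lam) Y
    positivity
  refine Real.iSup_le (fun ⟨b, hb⟩ => ?_) (by positivity)
  set M := ⌊2 * N⌋₊ with hM
  set L := Nat.log 2 M + 1 with hL
  set A : ℕ → ℕ → ℝ := fun m n => ‖∑ F, b F * ((ω F ^ (-(1 : ℝ) / 2) : ℝ) : ℂ) *
    ((starRingEnd ℂ) (lam F 1 m) * lam F 1 n)‖ ^ 2 with hA
  have hA0 : ∀ m n, 0 ≤ A m n := fun m n => by positivity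
  have hblock : ∀ j i : ℕ,
      (∑ d ∈ Icc 1 M, ∑ e ∈ Icc 1 M,
        (if ((d : ℝ) * e) ^ 3 * (2 ^ i * (2 ^ j) ^ 2) ≤ 2 * N then (1 : ℝ) else 0)) *
      ∑ m ∈ (Icc 1 M).filter (Nat.log 2 · = j), ∑ n ∈ (Icc 1 M).filter (Nat.log 2 · = i), A m n ≤
      (1 + 2 / ε) * N ^ ε * (16 * K * N ^ ε * S) := by
    intro j i
    set X : ℝ := 2 ^ i
    set Y : ℝ := 2 ^ j
    have hX : 1 ≤ X := one_le_pow₀ one_le_two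
    have hY : 1 ≤ Y := one_le_pow₀ one_le_two
    have hXY1 : 1 ≤ X * Y ^ 2 := one_le_mul_of_one_le_of_one_le hX (one_le_pow₀ hY)
    by_cases hXY : X * Y ^ 2 ≤ 2 * N
    · have hY2 : Y ≤ Y ^ 2 := le_self_pow₀ hY (by norm_num)
      have hXN : X ≤ 2 * N := by nlinarith
      have hYN : Y ≤ 2 * N := by nlinarith
      have hX1 := deltaOne_nonneg (ω := ω) (lam := lam) X
      have hY1 := deltaOne_nonneg (ω := ω) (lam := lam) Y
      have hcount := sum_sum_ite_cube_le M (Q := X * Y ^ 2) (x := 2 * N) (by positivity)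
        (by positivity)
      have hroot : (2 * N / (X * Y ^ 2)) ^ ((1 : ℝ) / 3) ≤
          2 * (N / (X * Y ^ 2)) ^ ((1 : ℝ) / 3) := by
        rw [mul_div_assoc, Real.mul_rpow (by norm_num) (by positivity)]
        gcongr
        exact Real.rpow_le_self_of_one_le (by norm_num) (by norm_num)
      have hmem : ∀ k n : ℕ, n ∈ (Icc 1 M).filter (Nat.log 2 · = k) →
          1 ≤ n ∧ (2 : ℝ) ^ k ≤ n ∧ (n : ℝ) ≤ 2 * 2 ^ k := fun k n hn =>
        ⟨(mem_Icc.1 (mem_filter.1 hn).1).1,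
          two_pow_le_of_log_eq (mem_Icc.1 (mem_filter.1 hn).1).1 (mem_filter.1 hn).2⟩
      have hB := sum_sum_norm_sq_le_min (ω := ω) hb hlam hX hY (hmem i) (hmem j)
      have hmin : min (DeltaOne 𝓕 ω lam X * (K * (2 * Y) ^ (1 + ε)))
          (DeltaOne 𝓕 ω lam Y * (K * (2 * X) ^ (1 + ε))) ≤
          8 * K * N ^ ε * min (Y * DeltaOne 𝓕 ω lam X) (X * DeltaOne 𝓕 ω lam Y) := by
        rw [mul_min_of_nonneg _ _ (by positivity)]
        refine min_le_min ?_ ?_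
        · calc _ ≤ DeltaOne 𝓕 ω lam X * (K * (8 * N ^ ε * Y)) := by
                gcongr
                exact two_mul_rpow_one_add_le hε0.le hε1 (by positivity) hYN
            _ = _ := by ring
        · calc _ ≤ DeltaOne 𝓕 ω lam Y * (K * (8 * N ^ ε * X)) := by
                gcongr
                exact two_mul_rpow_one_add_le hε0.le hε1 (by positivity) hXN
            _ = _ := by ring
      have hsup : (N / (X * Y ^ 2)) ^ ((1 : ℝ) / 3) *
          min (Y * DeltaOne 𝓕 ω lam X) (X * DeltaOne 𝓕 ω lam Y) ≤ S :=
        le_ciSup (bddAbove_range_mul_min_deltaOne (ω := ω) (lam := lam) hN0.le)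
          ⟨(X, Y), hX, hY, by linarith⟩
      have hlog := one_add_log_floor_le hε0 hε1 hN
      have hlog0 : 0 ≤ 1 + Real.log (M : ℝ) := by positivity
      calc _ ≤ (2 * (N / (X * Y ^ 2)) ^ ((1 : ℝ) / 3) * ((1 + 2 / ε) * N ^ ε)) *
            (8 * K * N ^ ε * min (Y * DeltaOne 𝓕 ω lam X) (X * DeltaOne 𝓕 ω lam Y)) := by
            refine mul_le_mul (hcount.trans ?_) (hB.trans hmin)
              (sum_nonneg fun m _ => sum_nonneg fun n _ => hA0 m n) (by positivity)
            gcongr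
        _ = (1 + 2 / ε) * N ^ ε * (16 * K * N ^ ε * ((N / (X * Y ^ 2)) ^ ((1 : ℝ) / 3) *
            min (Y * DeltaOne 𝓕 ω lam X) (X * DeltaOne 𝓕 ω lam Y))) := by ring
        _ ≤ _ := by gcongr
    · rw [sum_eq_zero, zero_mul]
      · positivity
      · refine fun d hd => sum_eq_zero fun e he => if_neg fun h => hXY (le_trans ?_ h)
        refine le_mul_of_one_le_left (by positivity) (one_le_pow₀ ?_)
        exact_mod_cast Nat.mul_pos (mem_Icc.1 hd).1 (mem_Icc.1 he).1
  have hhecke' : ∀ m ∈ Icc 1 M, ∀ n ∈ Icc 1 M,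
      ‖∑ F, b F * ((ω F ^ (-(1 : ℝ) / 2) : ℝ) : ℂ) * lam F m n‖ ^ 2 ≤
        2 * c * N ^ ε * ∑ e ∈ (Nat.gcd m n).divisors, A (m / e) (n / e) := by
    intro m hm n hn
    obtain ⟨hm1, hm2⟩ := mem_Icc.1 hm
    refine (norm_sum_hecke_sq_le b hhecke hdual hm1 (mem_Icc.1 hn).1).trans ?_
    have hgcd : ((Nat.gcd m n : ℕ) : ℝ) ≤ 2 * N :=
      le_trans (by exact_mod_cast (Nat.gcd_le_left n hm1).trans hm2)
        (Nat.floor_le (by positivity))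
    refine mul_le_mul_of_nonneg_right ?_ (sum_nonneg fun e _ => hA0 _ _)
    calc _ ≤ c * ((Nat.gcd m n : ℕ) : ℝ) ^ ε := hdiv _ (Nat.gcd_pos_of_pos_left n hm1).ne'
      _ ≤ c * (2 * N) ^ ε := by gcongr
      _ = c * (2 ^ ε * N ^ ε) := by rw [Real.mul_rpow (by norm_num) hN0.le]
      _ ≤ c * (2 * N ^ ε) := by
        gcongr
        exact Real.rpow_le_self_of_one_le (by norm_num) hε1
      _ = 2 * c * N ^ ε := by ring
  have hpow : N ^ (5 * ε) = (N ^ ε) ^ 5 := by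
    rw [← Real.rpow_natCast, ← Real.rpow_mul hN0.le]
    norm_num [mul_comm]
  have hLN : (L : ℝ) ≤ 2 * (1 + 2 / ε) * N ^ ε := natLog_floor_add_one_le hε0 hε1 hN
  calc _ ≤ _ := tsum_deltaThree_le_sum b N
    _ ≤ _ := sum_ite_le_of_le_sum_divisors M (2 * N) (by positivity) hA0 hhecke'
    _ ≤ 2 * c * N ^ ε * ∑ j ∈ range L, ∑ i ∈ range L,
          (1 + 2 / ε) * N ^ ε * (16 * K * N ^ ε * S) := by
        refine mul_le_mul_of_nonneg_left ?_ (by positivity)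
        exact (sum_ite_cube_le_sum_dyadic M (2 * N) hA0).trans
          (sum_le_sum fun j _ => sum_le_sum fun i _ => hblock j i)
    _ = 2 * c * N ^ ε * ((L : ℝ) ^ 2 * ((1 + 2 / ε) * N ^ ε * (16 * K * N ^ ε * S))) := by
        simp only [sum_const, card_range, nsmul_eq_mul]
        ring
    _ ≤ 2 * c * N ^ ε * ((2 * (1 + 2 / ε) * N ^ ε) ^ 2 *
          ((1 + 2 / ε) * N ^ ε * (16 * K * N ^ ε * S))) := by gcongr
    _ = _ := by
        rw [hpow]
        ring
end
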